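/- The set B = {φ₁+2φ₂+2φ₃, φ₁+φ₂+φ₃+φ₄, −(φ₁+φ₂+2φ₃), φ₃} is a base of Δ, and the positive system determined by B equals Δ_k⁺ ∪ {β ∈ Δ_n⁺ : β ≥ φ₁+2φ₂+2φ₃ or β ≥ φ₁+φ₂+φ₃+φ₄} ∪ (−{β ∈ Δ_n⁺ : β ≤ φ₁+φ₂+2φ₃}); in particular this positive system contains Δ_k⁺. -/

import Mathlib

noncomputable section

abbrev V : Type := Fin 4 → ℝ

def e (i : Fin 4) : V := Pi.single i 1

/-- The root system of type F₄ in ℝ⁴ (48 vectors). -/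
def Δ : Set V :=
  (⋃ i, ({e i, -e i} : Set V)) ∪
  (⋃ (i) (j) (_ : i < j), ({e i + e j, e i - e j, -e i + e j, -e i - e j} : Set V)) ∪
  {v | ∃ s : Fin 4 → ℝ, (∀ i, s i = 1 ∨ s i = -1) ∧ v = (1 / 2 : ℝ) • ∑ i, s i • e i}

def φ₁ : V := e 1 - e 2
def φ₂ : V := e 2 - e 3
def φ₃ : V := e 3
def φ₄ : V := (1 / 2 : ℝ) • (e 0 - e 1 - e 2 - e 3)

def φv : Fin 4 → V := ![φ₁, φ₂, φ₃, φ₄]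

/-- The coordinates `n₁(α), …, n₄(α)` of `α` with respect to the basis φ₁,…,φ₄:
for every `α : V` one has `α = ∑ i, n α i • φv i`. -/
def n (α : V) : Fin 4 → ℝ :=
  ![α 1 + α 0, α 1 + α 2 + 2 * α 0, α 1 + α 2 + α 3 + 3 * α 0, 2 * α 0]

/-- The highest root δ = 2φ₁+3φ₂+4φ₃+2φ₄ = e₁+e₂. -/
def δ : V := e 0 + e 1

/-- Compact roots: roots α with n₁(α) even. -/
def Δk : Set V := {α ∈ Δ | ∃ m : ℤ, n α 0 = 2 * m}

/-- Noncompact roots: roots α with n₁(α) odd. -/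
def Δn : Set V := {α ∈ Δ | ∃ m : ℤ, n α 0 = 2 * m + 1}

/-- Δ⁺: roots with all φ-coefficients nonnegative. -/
def Δp : Set V := {α ∈ Δ | ∀ i, 0 ≤ n α i}

def Δkp : Set V := Δp ∩ Δk
def Δnp : Set V := Δp ∩ Δn

/-- A positive system of Δ: the set of roots on which some root-regular linear
functional is positive. -/
def IsPosSystem (P : Set V) : Prop :=
  ∃ f : V →ₗ[ℝ] ℝ, (∀ α ∈ Δ, f α ≠ 0) ∧ P = {α ∈ Δ | 0 < f α}

/-- `le' γ β` means γ ≤ β, i.e. β − γ is a nonnegative integer combination of φ₁,…,φ₄. -/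
def le' (γ β : V) : Prop := ∃ c : Fin 4 → ℕ, β - γ = ∑ i, (c i : ℝ) • φv i

/-- A base of Δ: a linearly independent subset of Δ such that every root is an
integral combination with coefficients all ≥ 0 or all ≤ 0. -/
def IsBase (B : Finset V) : Prop :=
  ↑B ⊆ Δ ∧ LinearIndependent ℝ (Subtype.val : {x : V // x ∈ B} → V) ∧
  ∀ α ∈ Δ, ∃ c : V → ℤ,
    α = ∑ x ∈ B, (c x : ℝ) • x ∧ ((∀ x ∈ B, 0 ≤ c x) ∨ (∀ x ∈ B, c x ≤ 0))

/-- The positive system determined by a base B: roots whose B-coefficients are all ≥ 0. -/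
def posOf (B : Finset V) : Set V :=
  {α ∈ Δ | ∃ c : V → ℤ, α = ∑ x ∈ B, (c x : ℝ) • x ∧ ∀ x ∈ B, 0 ≤ c x}

/-- The point with integer coordinates `a` with respect to the simple roots `φv`. -/
def latticePoint (a : Fin 4 → ℤ) : V := ∑ i, (a i : ℝ) • φv i

/-- Twice the standard coordinates of `latticePoint a`. -/
def doubled (a : Fin 4 → ℤ) : Fin 4 → ℤ :=
  ![a 3, 2 * a 0 - a 3, 2 * (a 1 - a 0) - a 3, 2 * (a 2 - a 1) - a 3]

/-- The `φ`-coordinates of the new base. -/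
def baseCoord : Fin 4 → Fin 4 → ℤ :=
  ![![1, 2, 2, 0], ![1, 1, 1, 1], ![-1, -1, -2, 0], ![0, 0, 1, 0]]

/-- The new base, as an indexed family. -/
def baseVec (i : Fin 4) : V := latticePoint (baseCoord i)

/-- The coefficients of `latticePoint a` with respect to `baseVec`. -/
def baseCoeff (a : Fin 4 → ℤ) : Fin 4 → ℤ :=
  ![a 1 - a 0, a 3, a 1 + a 3 - 2 * a 0, a 2 - 2 * a 0 + a 3]

lemma latticePoint_apply (a : Fin 4 → ℤ) (i : Fin 4) :
    latticePoint a i = (doubled a i : ℝ) / 2 := by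
  fin_cases i <;>
    simp [latticePoint, doubled, Fin.sum_univ_four, φv, φ₁, φ₂, φ₃, φ₄, e] <;> ring

lemma n_latticePoint (a : Fin 4 → ℤ) (i : Fin 4) : n (latticePoint a) i = a i := by
  fin_cases i <;> simp [n, latticePoint_apply, doubled] <;> ring

lemma latticePoint_injective : Function.Injective latticePoint := by
  intro a b h
  funext i
  have := congrArg (fun v => n v i) h
  simpa [n_latticePoint] using this

lemma latticePoint_neg (a : Fin 4 → ℤ) : latticePoint (-a) = -latticePoint a := by
  simp [latticePoint, Finset.sum_neg_distrib]

lemma latticePoint_sub (a b : Fin 4 → ℤ) :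
    latticePoint (a - b) = latticePoint a - latticePoint b := by
  simp [latticePoint, sub_smul, Finset.sum_sub_distrib]

lemma le'_latticePoint {a b : Fin 4 → ℤ} :
    le' (latticePoint a) (latticePoint b) ↔ ∀ i, a i ≤ b i := by
  constructor
  · rintro ⟨c, hc⟩ i
    have h : b - a = fun j => (c j : ℤ) := latticePoint_injective <| by
      rw [latticePoint_sub, hc]
      simp [latticePoint]
    have := congrFun h i
    simp only [Pi.sub_apply] at this
    omega
  · intro h
    refine ⟨fun i => (b i - a i).toNat, ?_⟩
    rw [← latticePoint_sub, latticePoint]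
    refine Finset.sum_congr rfl fun i _ => ?_
    have : ((b i - a i).toNat : ℤ) = b i - a i := Int.toNat_of_nonneg (sub_nonneg.2 (h i))
    rw [Pi.sub_apply, ← this, Int.cast_natCast]

lemma latticePoint_mem_Δp {a : Fin 4 → ℤ} :
    latticePoint a ∈ Δp ↔ latticePoint a ∈ Δ ∧ ∀ i, 0 ≤ a i := by
  simp [Δp, n_latticePoint]

lemma latticePoint_mem_Δkp {a : Fin 4 → ℤ} :
    latticePoint a ∈ Δkp ↔ latticePoint a ∈ Δ ∧ (∀ i, 0 ≤ a i) ∧ a 0 % 2 = 0 := by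
  have : (∃ m : ℤ, (a 0 : ℝ) = 2 * m) ↔ a 0 % 2 = 0 := by
    constructor
    · rintro ⟨m, hm⟩
      have : a 0 = 2 * m := by exact_mod_cast hm
      omega
    · intro h
      have : a 0 = 2 * (a 0 / 2) := by omega
      exact ⟨a 0 / 2, by exact_mod_cast this⟩
  simp only [Δkp, Set.mem_inter_iff, latticePoint_mem_Δp, Δk, Set.mem_ofPred_eq, n_latticePoint,
    this]
  tauto

lemma latticePoint_mem_Δnp {a : Fin 4 → ℤ} :
    latticePoint a ∈ Δnp ↔ latticePoint a ∈ Δ ∧ (∀ i, 0 ≤ a i) ∧ a 0 % 2 = 1 := by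
  have : (∃ m : ℤ, (a 0 : ℝ) = 2 * m + 1) ↔ a 0 % 2 = 1 := by
    constructor
    · rintro ⟨m, hm⟩
      have : a 0 = 2 * m + 1 := by exact_mod_cast hm
      omega
    · intro h
      have : a 0 = 2 * (a 0 / 2) + 1 := by omega
      exact ⟨a 0 / 2, by exact_mod_cast this⟩
  simp only [Δnp, Set.mem_inter_iff, latticePoint_mem_Δp, Δn, Set.mem_ofPred_eq, n_latticePoint,
    this]
  tauto

lemma neg_mem_Δ {α : V} (h : α ∈ Δ) : -α ∈ Δ := by
  rcases h with (h | h) | ⟨s, hs, rfl⟩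
  · simp only [Set.mem_iUnion] at h
    obtain ⟨i, rfl | rfl⟩ := h
    · exact Or.inl (Or.inl (Set.mem_iUnion.2 ⟨i, by simp⟩))
    · exact Or.inl (Or.inl (Set.mem_iUnion.2 ⟨i, by simp⟩))
  · simp only [Set.mem_iUnion] at h
    obtain ⟨i, j, hij, h⟩ := h
    refine Or.inl (Or.inr ?_)
    simp only [Set.mem_iUnion]
    refine ⟨i, j, hij, ?_⟩
    rcases h with rfl | rfl | rfl | rfl
    · exact Or.inr (Or.inr (Or.inr (by simp; abel)))
    · exact Or.inr (Or.inr (Or.inl (by abel)))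
    · exact Or.inr (Or.inl (by abel))
    · exact Or.inl (by abel)
  · refine Or.inr ⟨-s, fun i => ?_, by simp [Finset.sum_neg_distrib]⟩
    rcases hs i with h | h <;> simp [h]

lemma exists_doubled_of_mem_Δ {α : V} (h : α ∈ Δ) :
    ∃ w : Fin 4 → ℤ, (∀ i, α i = (w i : ℝ) / 2) ∧ (∀ i, w i % 2 = w 0 % 2) ∧
      (∑ i, w i ^ 2 = 4 ∨ ∑ i, w i ^ 2 = 8) := by
  have two (i j : Fin 4) : (Pi.single i (1 : ℝ) : Fin 4 → ℝ) j =
      ((Pi.single i 2 : Fin 4 → ℤ) j : ℝ) / 2 := by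
    by_cases hj : j = i
    · subst hj; simp
    · simp [hj]
  rcases h with (h | h) | ⟨s, hs, rfl⟩
  · simp only [Set.mem_iUnion] at h
    obtain ⟨i, rfl | rfl⟩ := h
    · exact ⟨Pi.single i 2, two i, by decide +revert, by decide +revert⟩
    · exact ⟨-Pi.single i 2, fun j => by simp [e, two]; ring, by decide +revert, by decide +revert⟩
  · simp only [Set.mem_iUnion] at h
    obtain ⟨i, j, hij, rfl | rfl | rfl | rfl⟩ := h
    · exact ⟨Pi.single i 2 + Pi.single j 2, fun k => by simp [e, two]; ring,
        by decide +revert, by decide +revert⟩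
    · exact ⟨Pi.single i 2 - Pi.single j 2, fun k => by simp [e, two]; ring,
        by decide +revert, by decide +revert⟩
    · exact ⟨-Pi.single i 2 + Pi.single j 2, fun k => by simp [e, two]; ring,
        by decide +revert, by decide +revert⟩
    · exact ⟨-Pi.single i 2 - Pi.single j 2, fun k => by simp [e, two]; ring,
        by decide +revert, by decide +revert⟩
  · have hz (i : Fin 4) : ∃ z : ℤ, (z = 1 ∨ z = -1) ∧ s i = z := by
      rcases hs i with h | h
      · exact ⟨1, by simp [h]⟩
      · exact ⟨-1, by simp [h]⟩
    choose w hw hsw using hz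
    have hsq (i : Fin 4) : w i ^ 2 = 1 := by rcases hw i with h | h <;> simp [h]
    refine ⟨w, fun i => ?_, fun i => ?_, ?_⟩
    · simp [Finset.sum_apply, e, Pi.single_apply, hsw]; ring
    · rcases hw i with h | h <;> rcases hw 0 with h' | h' <;> simp [h, h']
    · simp [hsq]

lemma exists_latticePoint_of_mem_Δ {α : V} (h : α ∈ Δ) :
    ∃ a, α = latticePoint a ∧ (∑ i, doubled a i ^ 2 = 4 ∨ ∑ i, doubled a i ^ 2 = 8) := by
  obtain ⟨w, hα, hpar, hw⟩ := exists_doubled_of_mem_Δ h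
  let a : Fin 4 → ℤ := ![(w 1 + w 0) / 2, (w 1 + w 2 + 2 * w 0) / 2,
    (w 1 + w 2 + w 3 + 3 * w 0) / 2, w 0]
  have ha : doubled a = w := by
    have h1 := hpar 1
    have h2 := hpar 2
    have h3 := hpar 3
    funext i
    fin_cases i <;> simp [doubled, a] <;> omega
  refine ⟨a, funext fun i => ?_, by rwa [ha]⟩
  rw [hα, latticePoint_apply, ha]

set_option maxRecDepth 100000 in
/-- In `baseVec`-coordinates every root is nonnegative or nonpositive, and the nonnegative ones
are as described by their `φ`-coordinates. -/
lemma root_coord_classification {a : Fin 4 → ℤ}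
    (ha : ∑ i, doubled a i ^ 2 = 4 ∨ ∑ i, doubled a i ^ 2 = 8) :
    ((∀ i, 0 ≤ baseCoeff a i) ∨ ∀ i, baseCoeff a i ≤ 0) ∧
    ((∀ i, 0 ≤ baseCoeff a i) ↔
      ((∀ i, 0 ≤ a i) ∧ a 0 % 2 = 0) ∨
      (((∀ i, 0 ≤ a i) ∧ a 0 % 2 = 1) ∧
        ((∀ i, baseCoord 0 i ≤ a i) ∨ ∀ i, baseCoord 1 i ≤ a i)) ∨
      (((∀ i, 0 ≤ -a i) ∧ -a 0 % 2 = 1) ∧ ∀ i, -a i ≤ -baseCoord 2 i)) := by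
  have bound (i : Fin 4) : doubled a i ∈ Finset.Icc (-2 : ℤ) 2 := by
    have h : doubled a i ^ 2 ≤ ∑ j, doubled a j ^ 2 :=
      Finset.single_le_sum (f := fun j => doubled a j ^ 2) (fun j _ => sq_nonneg _)
        (Finset.mem_univ i)
    rw [Finset.mem_Icc]
    constructor <;> rcases ha with ha | ha <;> nlinarith
  have hsum : doubled a 0 ^ 2 + doubled a 1 ^ 2 + doubled a 2 ^ 2 + doubled a 3 ^ 2 = 4 ∨
      doubled a 0 ^ 2 + doubled a 1 ^ 2 + doubled a 2 ^ 2 + doubled a 3 ^ 2 = 8 := by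
    simpa only [Fin.sum_univ_four] using ha
  have hpar : doubled a 1 % 2 = doubled a 0 % 2 ∧ doubled a 2 % 2 = doubled a 0 % 2 ∧
      doubled a 3 % 2 = doubled a 0 % 2 := by
    simp [doubled]
  have ha' : a = ![(doubled a 1 + doubled a 0) / 2,
      (doubled a 1 + doubled a 2 + 2 * doubled a 0) / 2,
      (doubled a 1 + doubled a 2 + doubled a 3 + 3 * doubled a 0) / 2, doubled a 0] := by
    funext i
    fin_cases i <;> simp [doubled] <;> omega
  have b0 := bound 0
  have b1 := bound 1
  have b2 := bound 2
  have b3 := bound 3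
  clear ha bound
  generalize doubled a 0 = w₀ at *
  generalize doubled a 1 = w₁ at *
  generalize doubled a 2 = w₂ at *
  generalize doubled a 3 = w₃ at *
  subst ha'
  obtain ⟨p1, p2, p3⟩ := hpar
  -- This order of quantifiers lets the decision procedure discard wrong parities early.
  revert hsum
  revert w₃ p3
  revert w₂ p2
  revert w₁ p1
  revert w₀
  decide

lemma latticePoint_eq_sum_baseVec (a : Fin 4 → ℤ) :
    latticePoint a = ∑ i, (baseCoeff a i : ℝ) • baseVec i := by
  funext j
  simp only [Finset.sum_apply, Pi.smul_apply, baseVec, latticePoint_apply, smul_eq_mul]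
  fin_cases j <;> simp [Fin.sum_univ_four, doubled, baseCoeff, baseCoord] <;> ring

lemma linearIndependent_baseVec : LinearIndependent ℝ baseVec := by
  rw [Fintype.linearIndependent_iff]
  intro g hg
  have h (j : Fin 4) := congrFun hg j
  simp only [Finset.sum_apply, Pi.smul_apply, baseVec, latticePoint_apply, smul_eq_mul] at h
  have h0 := h 0
  have h1 := h 1
  have h2 := h 2
  have h3 := h 3
  simp [Fin.sum_univ_four, doubled, baseCoord] at h0 h1 h2 h3
  intro i
  fin_cases i <;> simp <;> linarith

lemma latticePoint_baseCoord_zero :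
    latticePoint (baseCoord 0) = φ₁ + (2 : ℝ) • φ₂ + (2 : ℝ) • φ₃ := by
  simp [latticePoint, baseCoord, Fin.sum_univ_four, φv]

lemma latticePoint_baseCoord_one : latticePoint (baseCoord 1) = φ₁ + φ₂ + φ₃ + φ₄ := by
  simp [latticePoint, baseCoord, Fin.sum_univ_four, φv]

lemma latticePoint_neg_baseCoord_two :
    latticePoint (-baseCoord 2) = φ₁ + φ₂ + (2 : ℝ) • φ₃ := by
  simp [latticePoint, baseCoord, Fin.sum_univ_four, φv]
  abel

lemma latticePoint_baseCoord_three : latticePoint (baseCoord 3) = φ₃ := by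
  simp [latticePoint, baseCoord, Fin.sum_univ_four, φv]

lemma baseFinset_eq_image :
    ({φ₁ + (2 : ℝ) • φ₂ + (2 : ℝ) • φ₃, φ₁ + φ₂ + φ₃ + φ₄, -(φ₁ + φ₂ + (2 : ℝ) • φ₃), φ₃} :
      Finset V) = Finset.univ.image baseVec := by
  have : (Finset.univ : Finset (Fin 4)) = {0, 1, 2, 3} := rfl
  rw [this, ← latticePoint_baseCoord_zero, ← latticePoint_baseCoord_one,
    ← latticePoint_neg_baseCoord_two, ← latticePoint_baseCoord_three, ← latticePoint_neg, neg_neg]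
  simp only [Finset.image_insert, Finset.image_singleton, baseVec]

lemma sum_image_baseVec (c : V → ℤ) :
    ∑ x ∈ Finset.univ.image baseVec, (c x : ℝ) • x = ∑ i, (c (baseVec i) : ℝ) • baseVec i :=
  Finset.sum_image linearIndependent_baseVec.injective.injOn

lemma exists_coeff_latticePoint (a : Fin 4 → ℤ) :
    ∃ c : V → ℤ, (∀ i, c (baseVec i) = baseCoeff a i) ∧
      latticePoint a = ∑ x ∈ Finset.univ.image baseVec, (c x : ℝ) • x := by
  have h := linearIndependent_baseVec.injective.extend_apply (baseCoeff a) 0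
  refine ⟨Function.extend baseVec (baseCoeff a) 0, h, ?_⟩
  simp only [sum_image_baseVec, h, latticePoint_eq_sum_baseVec a]

lemma latticePoint_mem_posOf {a : Fin 4 → ℤ} :
    latticePoint a ∈ posOf (Finset.univ.image baseVec) ↔
      latticePoint a ∈ Δ ∧ ∀ i, 0 ≤ baseCoeff a i := by
  refine and_congr_right fun _ => ⟨?_, fun h => ?_⟩
  · rintro ⟨c, hc, hpos⟩ i
    rw [sum_image_baseVec, latticePoint_eq_sum_baseVec] at hc
    have := linearIndependent_baseVec.eq_coords_of_eq hc i
    rw [Int.cast_inj.1 this]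
    exact hpos _ (Finset.mem_image_of_mem _ (Finset.mem_univ i))
  · obtain ⟨c, hc, hsum⟩ := exists_coeff_latticePoint a
    exact ⟨c, hsum, by simpa [hc] using h⟩

lemma baseVec_mem_Δ (i : Fin 4) : baseVec i ∈ Δ := by
  fin_cases i
  · refine Or.inl (Or.inr (Set.mem_iUnion₂.2 ⟨1, 2, Set.mem_iUnion.2 ⟨by decide, Or.inl ?_⟩⟩))
    funext j
    fin_cases j <;> simp [baseVec, latticePoint_apply, doubled, baseCoord, e]
  · refine Or.inr ⟨![1, 1, -1, -1], fun j => by fin_cases j <;> simp, ?_⟩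
    funext j
    fin_cases j <;>
      simp [baseVec, latticePoint_apply, doubled, baseCoord, e, Fin.sum_univ_four] <;> norm_num
  · refine Or.inl (Or.inr (Set.mem_iUnion₂.2 ⟨1, 3, Set.mem_iUnion.2
      ⟨by decide, Or.inr (Or.inr (Or.inr ?_))⟩⟩))
    rw [Set.mem_singleton_iff]
    funext j
    fin_cases j <;> simp [baseVec, latticePoint_apply, doubled, baseCoord, e]
  · refine Or.inl (Or.inl (Set.mem_iUnion.2 ⟨3, Or.inl ?_⟩))
    funext j
    fin_cases j <;> simp [baseVec, latticePoint_apply, doubled, baseCoord, e]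

lemma isBase_image_baseVec : IsBase (Finset.univ.image baseVec) := by
  refine ⟨by simpa [Set.range_subset_iff] using baseVec_mem_Δ, ?_, fun α hα => ?_⟩
  · have := linearIndependent_baseVec.linearIndepOn_id
    rw [← Set.image_univ, ← Finset.coe_univ, ← Finset.coe_image] at this
    exact this
  · obtain ⟨a, rfl, ha⟩ := exists_latticePoint_of_mem_Δ hα
    obtain ⟨c, hc, hsum⟩ := exists_coeff_latticePoint a
    exact ⟨c, hsum, by simpa [hc] using (root_coord_classification ha).1⟩

theorem stmt10 :
    IsBase ({φ₁ + (2 : ℝ) • φ₂ + (2 : ℝ) • φ₃, φ₁ + φ₂ + φ₃ + φ₄, -(φ₁ + φ₂ + (2 : ℝ) • φ₃), φ₃} : Finset V) ∧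
    posOf ({φ₁ + (2 : ℝ) • φ₂ + (2 : ℝ) • φ₃, φ₁ + φ₂ + φ₃ + φ₄, -(φ₁ + φ₂ + (2 : ℝ) • φ₃), φ₃} : Finset V) =
      Δkp ∪ {β ∈ Δnp | le' (φ₁ + (2 : ℝ) • φ₂ + (2 : ℝ) • φ₃) β ∨ le' (φ₁ + φ₂ + φ₃ + φ₄) β} ∪ (Neg.neg '' {β ∈ Δnp | le' β (φ₁ + φ₂ + (2 : ℝ) • φ₃)}) ∧
    Δkp ⊆ posOf ({φ₁ + (2 : ℝ) • φ₂ + (2 : ℝ) • φ₃, φ₁ + φ₂ + φ₃ + φ₄, -(φ₁ + φ₂ + (2 : ℝ) • φ₃), φ₃} : Finset V) := by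
  rw [baseFinset_eq_image, ← latticePoint_baseCoord_zero, ← latticePoint_baseCoord_one,
    ← latticePoint_neg_baseCoord_two]
  have hpos : posOf (Finset.univ.image baseVec) =
      Δkp ∪ {β ∈ Δnp | le' (latticePoint (baseCoord 0)) β ∨ le' (latticePoint (baseCoord 1)) β} ∪
        (Neg.neg '' {β ∈ Δnp | le' β (latticePoint (-baseCoord 2))}) := by
    have hroot : ∀ α ∈ Δ, (α ∈ posOf (Finset.univ.image baseVec) ↔ α ∈
        Δkp ∪ {β ∈ Δnp | le' (latticePoint (baseCoord 0)) β ∨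
          le' (latticePoint (baseCoord 1)) β} ∪
        (Neg.neg '' {β ∈ Δnp | le' β (latticePoint (-baseCoord 2))})) := by
      intro α hα
      obtain ⟨a, rfl, ha⟩ := exists_latticePoint_of_mem_Δ hα
      have hneg := neg_mem_Δ hα
      rw [← latticePoint_neg] at hneg
      rw [Set.image_neg_eq_neg, latticePoint_mem_posOf, (root_coord_classification ha).2]
      simp only [Set.mem_union, Set.mem_neg, Set.mem_ofPred_eq, ← latticePoint_neg,
        latticePoint_mem_Δkp, latticePoint_mem_Δnp, le'_latticePoint, hα, hneg, true_and,
        Pi.neg_apply, or_assoc]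
    ext α
    refine ⟨fun h => (hroot α h.1).1 h, fun h => (hroot α ?_).2 h⟩
    rcases h with (h | h) | ⟨β, h, rfl⟩
    · exact h.1.1
    · exact h.1.1.1
    · exact neg_mem_Δ h.1.1.1
  refine ⟨isBase_image_baseVec, hpos, ?_⟩
  rw [hpos]
  exact fun α hα => Or.inl (Or.inl hα)
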